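/- Let X be a compact Hausdorff topological space and let f, g : X × [0,1] → ℝ be continuous functions such that for every λ ∈ ℝ, every x₀ ∈ X and every t₀ ∈ [0,1], the sets {x ∈ X : f(x,t₀) ≥ λ} and {t ∈ [0,1] : g(x₀,t) ≥ λ} are connected. Then there exists (x*,t*) ∈ X × [0,1] with f(x*,t*) = max_{x ∈ X} f(x,t*) and g(x*,t*) = max_{t ∈ [0,1]} g(x*,t). -/

import Mathlib

theorem nash_equilibrium_connected_sections
    {X : Type*} [TopologicalSpace X] [CompactSpace X] [T2Space X] [Nonempty X]
    (f g : X × unitInterval → ℝ)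
    (hf : Continuous f) (hg : Continuous g)
    (hconn : ∀ l : ℝ, ∀ x₀ : X, ∀ t₀ : unitInterval,
      IsPreconnected {x : X | l ≤ f (x, t₀)} ∧
      IsPreconnected {t : unitInterval | l ≤ g (x₀, t)}) :
    ∃ x : X, ∃ t : unitInterval,
      (∀ x' : X, f (x', t) ≤ f (x, t)) ∧
      (∀ t' : unitInterval, g (x, t') ≤ g (x, t)) := by 
  classical
  have hA : IsClosed {p : X × unitInterval | ∀ x', f (x', p.2) ≤ f p} := by
    simp only [Set.ofPred_forall]
    exact isClosed_iInter fun x' => isClosed_le (by fun_prop) (by fun_prop)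
  have hB : IsClosed {p : X × unitInterval | ∀ t', g (p.1, t') ≤ g p} := by
    simp only [Set.ofPred_forall]
    exact isClosed_iInter fun x' => isClosed_le (by fun_prop) (by fun_prop)
  have exA : ∀ t, ∃ x, ∀ x', f (x', t) ≤ f (x, t) := by
    intro t
    obtain ⟨x, -, hx⟩ := isCompact_univ.exists_isMaxOn (Set.univ_nonempty (α := X))
      (f := fun x => f (x, t)) (by fun_prop)
    exact ⟨x, fun x' => hx (Set.mem_univ x')⟩
  have exB : ∀ x, ∃ t, ∀ t', g (x, t') ≤ g (x, t) := by
    intro x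
    obtain ⟨t, -, ht⟩ := isCompact_univ.exists_isMaxOn (Set.univ_nonempty (α := unitInterval))
      (f := fun t => g (x, t)) (by fun_prop)
    exact ⟨t, fun t' => ht (Set.mem_univ t')⟩
  have hU : IsClosed {p : X × unitInterval | ∃ s, p.2 ≤ s ∧ ∀ t', g (p.1, t') ≤ g (p.1, s)} := by
    have h1 : IsClosed {q : (X × unitInterval) × unitInterval |
        q.1.2 ≤ q.2 ∧ ∀ t', g (q.1.1, t') ≤ g (q.1.1, q.2)} :=
      (isClosed_le (by fun_prop) (by fun_prop)).inter
        (hB.preimage (f := fun q : (X × unitInterval) × unitInterval => (q.1.1, q.2))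
          (by fun_prop))
    convert isClosedMap_fst_of_compactSpace _ h1 using 1
    ext p
    simp
  have hV : IsClosed {p : X × unitInterval | ∃ s, s ≤ p.2 ∧ ∀ t', g (p.1, t') ≤ g (p.1, s)} := by
    have h1 : IsClosed {q : (X × unitInterval) × unitInterval |
        q.2 ≤ q.1.2 ∧ ∀ t', g (q.1.1, t') ≤ g (q.1.1, q.2)} :=
      (isClosed_le (by fun_prop) (by fun_prop)).inter
        (hB.preimage (f := fun q : (X × unitInterval) × unitInterval => (q.1.1, q.2))
          (by fun_prop))
    convert isClosedMap_fst_of_compactSpace _ h1 using 1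
    ext p
    simp
  set U := {p : X × unitInterval | ∃ s, p.2 ≤ s ∧ ∀ t', g (p.1, t') ≤ g (p.1, s)} with hUd
  set V := {p : X × unitInterval | ∃ s, s ≤ p.2 ∧ ∀ t', g (p.1, t') ≤ g (p.1, s)} with hVd
  set A := {p : X × unitInterval | ∀ x', f (x', p.2) ≤ f p} with hAd
  have cov : ∀ p, p ∈ U ∨ p ∈ V := by
    intro p
    obtain ⟨s, hs⟩ := exB p.1
    rcases le_total p.2 s with h | h
    · exact Or.inl ⟨s, h, hs⟩
    · exact Or.inr ⟨s, h, hs⟩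
  have hP := ((hA.inter hU).isCompact.image continuous_snd).isClosed
  have hQ := ((hA.inter hV).isCompact.image continuous_snd).isClosed
  obtain ⟨t, -, ⟨⟨x₁, t₁⟩, ⟨hA1, hU1⟩, ht1⟩, ⟨⟨x₂, t₂⟩, ⟨hA2, hV2⟩, ht2⟩⟩ :=
    isPreconnected_closed_iff.1 (isPreconnected_univ (α := unitInterval)) _ _ hP hQ
      (by
        intro t _
        obtain ⟨x, hx⟩ := exA t
        rcases cov (x, t) with h | h
        · exact Or.inl ⟨(x, t), ⟨hx, h⟩, rfl⟩
        · exact Or.inr ⟨(x, t), ⟨hx, h⟩, rfl⟩)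
      (by
        obtain ⟨x, hx⟩ := exA 0
        obtain ⟨s, hs⟩ := exB x
        exact ⟨0, trivial, (x, 0), ⟨hx, s, unitInterval.nonneg', hs⟩, rfl⟩)
      (by
        obtain ⟨x, hx⟩ := exA 1
        obtain ⟨s, hs⟩ := exB x
        exact ⟨1, trivial, (x, 1), ⟨hx, s, unitInterval.le_one', hs⟩, rfl⟩)
  simp only at ht1 ht2
  subst ht1
  subst ht2
  have hc := (hconn (f (x₁, t₂)) x₁ t₂).1
  obtain ⟨x, hx, ⟨s, hs, hsm⟩, ⟨r, hr, hrm⟩⟩ := isPreconnected_closed_iff.1 hc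
    ((fun x => (x, t₂)) ⁻¹' U) ((fun x => (x, t₂)) ⁻¹' V)
    (hU.preimage (by fun_prop)) (hV.preimage (by fun_prop))
    (fun x _ => cov (x, t₂)) ⟨x₁, le_refl (f (x₁, t₂)), hU1⟩ ⟨x₂, hA2 x₁, hV2⟩
  refine ⟨x, t₂, fun x' => (hA1 x').trans hx, ?_⟩
  have ho := (hconn (g (x, s)) x t₂).2.ordConnected
  have := ho.out (show r ∈ _ from hrm s) (show s ∈ _ from le_refl (g (x, s))) ⟨hr, hs⟩
  exact fun t' => (hsm t').trans this
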